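/- arXiv:1210.3589 — 2 statements merged into one kernel-verified Lean document; each statement's English description precedes it below -/
import Mathlib

section
/- Let (R, m, k) be a Noetherian local ring of prime characteristic p > 0 with perfect residue field k, and let M be an R-module of finite length admitting an injective Frobenius action ρ (an additive map ρ : M → M with ρ(rm) = r^p ρ(m) for all r ∈ R, m ∈ M). Then m·M = 0, so that M is a finite-dimensional k-vector space, and ρ is bijective. -/
/-!
Horiuchi–Miller–Shimomoto, Lemma 2.4 (`lemma2`): finite length modules with an injective
Frobenius action over a local ring with perfect residue field.
-/

open IsLocalRing

/-- An element of the Jacobson radical acts nilpotently on a Noetherian and Artinian module. -/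
theorem exists_pow_smul_eq_zero_of_mem_jacobson {R M : Type*} [CommRing R] [AddCommGroup M]
    [Module R M] [IsNoetherian R M] [IsArtinian R M] {r : R}
    (hr : r ∈ (⊥ : Ideal R).jacobson) : ∃ n : ℕ, ∀ x : M, r ^ n • x = 0 := by
  obtain ⟨n, hn⟩ := IsArtinian.monotone_stabilizes
    (LinearMap.iterateRange (Module.toModuleEnd R M r))
  have hmem (x : M) : r ^ n • x ∈ LinearMap.range (Module.toModuleEnd R M r ^ n) :=
    ⟨x, by rw [← map_pow]; rfl⟩
  have hbot : LinearMap.range (Module.toModuleEnd R M r ^ n) = ⊥ := by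
    refine Submodule.eq_bot_of_le_smul_of_le_jacobson_bot (Ideal.span {r}) _
      (IsNoetherian.noetherian _) ?_ (by simpa [Ideal.span_le] using hr)
    have h := hn (n + 1) n.le_succ
    change LinearMap.range (Module.toModuleEnd R M r ^ n) =
      LinearMap.range (Module.toModuleEnd R M r ^ (n + 1)) at h
    intro x hx
    rw [h] at hx
    obtain ⟨y, rfl⟩ := hx
    rw [pow_succ', Module.End.mul_apply]
    exact Submodule.smul_mem_smul (Ideal.mem_span_singleton_self r) ⟨y, rfl⟩
  exact ⟨n, fun x => (Submodule.mem_bot R).mp (hbot ▸ hmem x)⟩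

/-- Iterating a `p`-linear map `n` times gives a `p ^ n`-linear map. -/
theorem iterate_smul_of_map_smul_eq_pow_smul {R M : Type*} [Monoid R] [MulAction R M] {p : ℕ}
    {f : M → M} (hf : ∀ (r : R) (x : M), f (r • x) = r ^ p • f x) (n : ℕ) (r : R) (x : M) :
    f^[n] (r • x) = r ^ p ^ n • f^[n] x := by
  induction n with
  | zero => simp
  | succ n ih => simp only [Function.iterate_succ_apply', ih, hf, ← pow_mul, ← pow_succ]

/-- An injective additive endomorphism `f` of an Artinian module is surjective if every scalar
can be moved inside `f` at the cost of replacing it by another scalar. -/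
theorem surjective_of_injective_of_smul_map_eq {R M : Type*} [Ring R] [AddCommGroup M]
    [Module R M] [IsArtinian R M] (f : M →+ M) (hinj : Function.Injective f)
    (hsmul : ∀ r : R, ∃ s : R, ∀ x : M, r • f x = f (s • x)) :
    Function.Surjective f := by
  have hiter (n : ℕ) : ∀ r : R, ∃ s : R, ∀ x : M, r • f^[n] x = f^[n] (s • x) := by
    induction n with
    | zero => exact fun r => ⟨r, fun _ => rfl⟩
    | succ n ih =>
      intro r
      obtain ⟨s, hs⟩ := ih r
      obtain ⟨t, ht⟩ := hsmul s
      exact ⟨t, fun x => by simp only [Function.iterate_succ_apply, hs, ht]⟩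
  let N (n : ℕ) : Submodule R M :=
    { carrier := Set.range f^[n]
      zero_mem' := ⟨0, iterate_map_zero f n⟩
      add_mem' := by
        rintro _ _ ⟨x, rfl⟩ ⟨y, rfl⟩
        exact ⟨x + y, iterate_map_add f n x y⟩
      smul_mem' := by
        rintro r _ ⟨x, rfl⟩
        obtain ⟨s, hs⟩ := hiter n r
        exact ⟨s • x, (hs x).symm⟩ }
  have hN : Antitone N := antitone_nat_of_succ_le fun n => by
    rintro _ ⟨x, rfl⟩
    exact ⟨f x, rfl⟩
  obtain ⟨n, hn⟩ := IsArtinian.monotone_stabilizes ⟨fun n => OrderDual.toDual (N n), hN⟩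
  have h : N n = N (n + 1) := hn (n + 1) n.le_succ
  intro x
  have hx : f^[n] x ∈ N n := ⟨x, rfl⟩
  rw [h] at hx
  obtain ⟨y, hy⟩ := hx
  exact ⟨y, hinj.iterate n hy⟩

/-- Let `(R, m, k)` be a Noetherian local ring of prime characteristic `p > 0` with perfect
residue field, and `M` a finite length `R`-module with an injective Frobenius action `ρ`
(an additive map with `ρ (r • m) = r^p • ρ m`).  Then `m • M = 0`, so `M` is a
finite-dimensional `k`-vector space, and `ρ` is bijective. -/
theorem finite_length_module_injective_frobenius_action
    (R : Type) [CommRing R] [IsNoetherianRing R] [IsLocalRing R]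
    (p : ℕ) [Fact p.Prime] [CharP R p]
    [CharP (ResidueField R) p] [PerfectRing (ResidueField R) p]
    (M : Type) [AddCommGroup M] [Module R M] (hM : IsFiniteLength R M)
    (ρ : M →+ M) (hρ : ∀ (r : R) (m : M), ρ (r • m) = r ^ p • ρ m)
    (hinj : Function.Injective ρ) :
    (∀ r ∈ maximalIdeal R, ∀ m : M, r • m = 0) ∧ Function.Bijective ρ := by
  obtain ⟨_, _⟩ := isFiniteLength_iff_isNoetherian_isArtinian.mp hM
  have hp : 1 < p := (Fact.out : p.Prime).one_lt
  have hzero : ∀ r ∈ maximalIdeal R, ∀ m : M, r • m = 0 := by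
    intro r hr m
    obtain ⟨n, hn⟩ := exists_pow_smul_eq_zero_of_mem_jacobson (M := M)
      ((maximalIdeal_le_jacobson ⊥) hr)
    apply hinj.iterate n
    rw [iterate_smul_of_map_smul_eq_pow_smul hρ, iterate_map_zero,
      ← Nat.sub_add_cancel (Nat.lt_pow_self hp : n < p ^ n).le, pow_add, mul_smul, hn, smul_zero]
  refine ⟨hzero, hinj, surjective_of_injective_of_smul_map_eq (R := R) ρ hinj fun r => ?_⟩
  obtain ⟨a, ha⟩ := (PerfectRing.bijective_frobenius (R := ResidueField R) (p := p)).2 (residue R r)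
  obtain ⟨s, rfl⟩ := residue_surjective a
  have hmem : r - s ^ p ∈ maximalIdeal R := by
    rw [← residue_eq_zero_iff, map_sub, map_pow, sub_eq_zero]
    exact ha.symm
  refine ⟨s, fun x => ?_⟩
  rw [hρ, ← sub_eq_zero, ← sub_smul, hzero _ hmem]
end

section
/- Let (R, m, k) be a Noetherian local ring and let x ∈ R be a non-zero-divisor such that m^s · H_m^i(R/xR) = 0 for some s > 0 and some i ≥ 0. Then m^{sℓ} · H_m^i(R/x^ℓ R) = 0 for every ℓ > 0. In particular, if R/xR has finite local cohomology (FLC), then so does R/x^ℓ R for every ℓ > 0. -/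
/-!
Horiuchi–Miller–Shimomoto, Lemma 4.3 (`lemma3`): annihilation of local cohomology of
infinitesimal thickenings, and deformation of the FLC property to thickenings.
-/

open CategoryTheory IsLocalRing

/-- The `R`-module `R/J` has finite local cohomology (FLC): `H_m^i(R/J)` has finite length
for all `i ≤ dim (R/J) − 1`, i.e. for all `i < dim (R/J)`. -/
noncomputable def HasFLCQuot (R : Type) [CommRing R] [IsLocalRing R] (J : Ideal R) : Prop :=
  ∀ i : ℕ, (i : WithBot ℕ∞) < ringKrullDim (R ⧸ J) →
    IsFiniteLength R ((localCohomology (maximalIdeal R) i).obj (ModuleCat.of R (R ⧸ J)))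

open Limits Opposite

universe u

theorem linearYoneda_map_comp_map (R : Type*) [CommRing R] {C : Type*} [Category* C]
    [Preadditive C] [Linear R C] (P : C) (S : ShortComplex C) :
    ((linearYoneda R C).map S.f).app (op P) ≫ ((linearYoneda R C).map S.g).app (op P) = 0 := by
  rw [← NatTrans.comp_app, ← Functor.map_comp, S.zero]
  ext
  simp

/-- `Hom(P, -)` preserves short exact sequences when `P` is projective. -/
theorem linearYoneda_shortExact {R : Type*} [CommRing R] {C : Type*} [Category* C]
    [Abelian C] [Linear R C] (P : C) [Projective P] {S : ShortComplex C} (hS : S.ShortExact) :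
    (ShortComplex.mk (((linearYoneda R C).map S.f).app (op P))
      (((linearYoneda R C).map S.g).app (op P))
      (linearYoneda_map_comp_map R P S)).ShortExact := by
  have := hS.mono_f
  have := hS.epi_g
  refine ShortComplex.ShortExact.mk' ?_ ?_ ?_
  · rw [ShortComplex.moduleCat_exact_iff]
    intro (u : P ⟶ S.X₂) (hu : u ≫ S.g = 0)
    exact ⟨hS.exact.lift u hu, hS.exact.lift_f u hu⟩
  · rw [ModuleCat.mono_iff_injective]
    intro (u : P ⟶ S.X₁) (v : P ⟶ S.X₁) (huv : u ≫ S.f = v ≫ S.f)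
    exact (cancel_mono S.f).1 huv
  · rw [ModuleCat.epi_iff_surjective]
    intro (u : P ⟶ S.X₃)
    exact ⟨Projective.factorThru u S.g, Projective.factorThru_comp u S.g⟩

/-- A sequence of additive functors which is short exact on projective objects induces
sequences of left derived functors that are exact in the middle. -/
theorem NatTrans.leftDerived_exact {C D : Type*} [Category* C] [Category* D] [Abelian C]
    [Abelian D] [HasProjectiveResolutions C] {F G H : C ⥤ D} [F.Additive] [G.Additive] [H.Additive]
    (φ : F ⟶ G) (ψ : G ⟶ H) (zero : φ ≫ ψ = 0)
    (hφψ : ∀ (P : C) [Projective P], (ShortComplex.mk (φ.app P) (ψ.app P)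
      (by rw [← NatTrans.comp_app, zero, zero_app])).ShortExact) (n : ℕ) (X : C) :
    ∃ h, (ShortComplex.mk ((NatTrans.leftDerived φ n).app X)
      ((NatTrans.leftDerived ψ n).app X) h).Exact := by
  let P := projectiveResolution X
  let T : ShortComplex (ChainComplex D ℕ) := ShortComplex.mk
    ((NatTrans.mapHomologicalComplex φ _).app P.complex)
    ((NatTrans.mapHomologicalComplex ψ _).app P.complex)
    (by ext i; exact congr_app zero _)
  have hT : T.ShortExact := HomologicalComplex.shortExact_of_degreewise_shortExact _
    fun i => hφψ (P.complex.X i)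
  let eF : (F.leftDerived n).obj X ≅ T.X₁.homology n := P.isoLeftDerivedObj F n
  let eG : (G.leftDerived n).obj X ≅ T.X₂.homology n := P.isoLeftDerivedObj G n
  let eH : (H.leftDerived n).obj X ≅ T.X₃.homology n := P.isoLeftDerivedObj H n
  have hφ : eF.hom ≫ HomologicalComplex.homologyMap T.f n =
      (NatTrans.leftDerived φ n).app X ≫ eG.hom :=
    ((Iso.eq_comp_inv _).1 ((P.leftDerived_app_eq φ n).trans (Category.assoc _ _ _).symm)).symm
  have hψ : eG.hom ≫ HomologicalComplex.homologyMap T.g n =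
      (NatTrans.leftDerived ψ n).app X ≫ eH.hom :=
    ((Iso.eq_comp_inv _).1 ((P.leftDerived_app_eq ψ n).trans (Category.assoc _ _ _).symm)).symm
  refine ⟨?_, (ShortComplex.exact_iff_of_iso
    (ShortComplex.isoMk eF eG eH hφ hψ)).2 (hT.homology_exact₂ n)⟩
  rw [← cancel_mono eH.hom, Category.assoc, ← hψ, ← reassoc_of% hφ,
    ← HomologicalComplex.homologyMap_comp, T.zero, HomologicalComplex.homologyMap_zero,
    comp_zero, zero_comp]

/-- `Ext^n(X, -)` is half exact. -/
theorem Ext_exact₂ {R : Type*} [CommRing R] {C : Type*} [Category* C] [Abelian C]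
    [Linear R C] [EnoughProjectives C] (n : ℕ) (X : C) {S : ShortComplex C} (hS : S.ShortExact) :
    ∃ h, (ShortComplex.mk (((Ext R C n).obj (op X)).map S.f)
      (((Ext R C n).obj (op X)).map S.g) h).Exact := by
  obtain ⟨h, h'⟩ := NatTrans.leftDerived_exact ((linearYoneda R C).map S.g).rightOp
    ((linearYoneda R C).map S.f).rightOp
    (by ext Y; exact congrArg Quiver.Hom.op (linearYoneda_map_comp_map R Y S))
    (fun P _ => (linearYoneda_shortExact (R := R) P hS).op) n X
  exact ⟨congrArg Quiver.Hom.unop h, h'.unop⟩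

/-- Exactness in a functor category may be checked pointwise. -/
theorem exact_of_exact_app {J C : Type*} [Category* J] [Category* C] [Abelian C]
    (S : ShortComplex (J ⥤ C)) (h : ∀ j, (S.map ((evaluation J C).obj j)).Exact) : S.Exact := by
  simp only [ShortComplex.exact_iff_isZero_homology, Functor.isZero_iff] at h ⊢
  exact fun j => (h j).of_iso (S.mapHomologyIso ((evaluation J C).obj j)).symm

/-- Local cohomology is half exact: it is a filtered colimit of `Ext` functors. -/
theorem localCohomology_exact₂ {R : Type u} [CommRing R] (J : Ideal R) (n : ℕ)
    {S : ShortComplex (ModuleCat.{u} R)} (hS : S.ShortExact) :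
    Function.Exact ((localCohomology J n).map S.f) ((localCohomology J n).map S.g) := by
  let D := localCohomology.diagram (localCohomology.idealPowersDiagram J) n
  have hc := colimit.isColimit D
  let T : ShortComplex (ℕᵒᵖᵒᵖ ⥤ ModuleCat R) := ShortComplex.mk
    (X₁ := D.flip.obj S.X₁) (X₂ := D.flip.obj S.X₂) (X₃ := D.flip.obj S.X₃)
    (D.flip.map S.f) (D.flip.map S.g) (by ext1; ext1 j; exact (Ext_exact₂ n _ hS).choose)
  have hT : T.Exact := exact_of_exact_app T fun j => (Ext_exact₂ n _ hS).choose_spec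
  have : AB5OfSize.{0, 0} (ModuleCat.{u} R) := AB5OfSize_of_univLE.{0, 0, u, u} _
  let E (M) := isColimitOfPreserves ((evaluation _ (ModuleCat R)).obj M) hc
  have := colim.exact_mapShortComplex hT (E S.X₁) (E S.X₂) (E S.X₃)
    ((localCohomology J n).map S.f) ((localCohomology J n).map S.g)
    (fun j => (((colimit.cocone D).ι.app j).naturality S.f).symm)
    (fun j => (((colimit.cocone D).ι.app j).naturality S.g).symm)
  exact (ShortComplex.ShortExact.moduleCat_exact_iff_function_exact _).1 this

/-- The sequence `0 → R ⧸ (a) → R ⧸ (a * b) → R ⧸ (b) → 0` whose first map is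
multiplication by `b`. -/
noncomputable def quotientMulShortComplex {R : Type u} [CommRing R] (a b : R) :
    ShortComplex (ModuleCat.{u} R) where
  X₁ := .of R (R ⧸ Ideal.span {a})
  X₂ := .of R (R ⧸ Ideal.span {a * b})
  X₃ := .of R (R ⧸ Ideal.span {b})
  f := ModuleCat.ofHom (Submodule.mapQ _ _ (LinearMap.mulRight R b) (by
    rw [← Submodule.map_le_iff_le_comap, Ideal.span, Submodule.map_span, Set.image_singleton]
    rfl))
  g := ModuleCat.ofHom (Submodule.factor
    (Ideal.span_singleton_le_span_singleton.2 (dvd_mul_left b a)))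
  zero := by
    ext1
    refine Submodule.linearMap_qext _ (LinearMap.ext fun r => ?_)
    exact (Submodule.Quotient.mk_eq_zero _).2 (Ideal.mem_span_singleton'.2 ⟨r, rfl⟩)

theorem quotientMulShortComplex_shortExact {R : Type u} [CommRing R] (a : R) {b : R}
    (hb : b ∈ nonZeroDivisors R) : (quotientMulShortComplex a b).ShortExact := by
  refine ShortComplex.ShortExact.mk' ?_ ?_ ?_
  · rw [ShortComplex.moduleCat_exact_iff]
    intro z hz
    obtain ⟨r, rfl⟩ := Submodule.Quotient.mk_surjective _ z
    obtain ⟨t, rfl⟩ := Ideal.mem_span_singleton'.1 ((Submodule.Quotient.mk_eq_zero _).1 hz)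
    exact ⟨Submodule.Quotient.mk t, rfl⟩
  · rw [ModuleCat.mono_iff_injective, injective_iff_map_eq_zero]
    intro z hz
    obtain ⟨r, rfl⟩ := Submodule.Quotient.mk_surjective _ z
    obtain ⟨t, ht⟩ := Ideal.mem_span_singleton'.1 ((Submodule.Quotient.mk_eq_zero _).1 hz)
    refine (Submodule.Quotient.mk_eq_zero _).2 (Ideal.mem_span_singleton'.2 ⟨t, ?_⟩)
    exact (mul_cancel_right_mem_nonZeroDivisors hb).1 ((mul_assoc t a b).trans ht)
  · rw [ModuleCat.epi_iff_surjective]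
    exact Submodule.factor_surjective
      (Ideal.span_singleton_le_span_singleton.2 (dvd_mul_left b a))

theorem localCohomology_quotient_mul_exact {R : Type u} [CommRing R] (J : Ideal R) (n : ℕ)
    (a : R) {b : R} (hb : b ∈ nonZeroDivisors R) :
    ∃ (f : (localCohomology J n).obj (.of R (R ⧸ Ideal.span {a})) →ₗ[R]
        (localCohomology J n).obj (.of R (R ⧸ Ideal.span {a * b})))
      (g : (localCohomology J n).obj (.of R (R ⧸ Ideal.span {a * b})) →ₗ[R]
        (localCohomology J n).obj (.of R (R ⧸ Ideal.span {b}))), Function.Exact f g :=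
  ⟨_, _, localCohomology_exact₂ J n (quotientMulShortComplex_shortExact a hb)⟩

/-- In an exact sequence `M → N → P`, if `I` annihilates `M` and `J` annihilates `P`, then
`I * J` annihilates `N`. -/
theorem smul_eq_zero_of_exact {R M N P : Type*} [CommRing R] [AddCommGroup M] [AddCommGroup N]
    [AddCommGroup P] [Module R M] [Module R N] [Module R P] {f : M →ₗ[R] N} {g : N →ₗ[R] P}
    (h : Function.Exact f g) {I J : Ideal R} (hM : ∀ y ∈ I, ∀ z : M, y • z = 0)
    (hP : ∀ y ∈ J, ∀ z : P, y • z = 0) {y : R} (hy : y ∈ I * J) (z : N) : y • z = 0 := by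
  induction hy using Submodule.mul_induction_on' with
  | mem_mul_mem a ha b hb =>
    obtain ⟨w, hw⟩ := (h (b • z)).1 (by rw [map_smul, hP b hb])
    rw [mul_smul, ← hw, ← map_smul, hM a ha, map_zero]
  | add a _ b _ ha hb => rw [add_smul, ha, hb, add_zero]

theorem IsFiniteLength.of_exact {R M N P : Type*} [Ring R] [AddCommGroup M] [AddCommGroup N]
    [AddCommGroup P] [Module R M] [Module R N] [Module R P] {f : M →ₗ[R] N} {g : N →ₗ[R] P}
    (h : Function.Exact f g) (hM : IsFiniteLength R M) (hP : IsFiniteLength R P) :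
    IsFiniteLength R N := by
  rw [isFiniteLength_iff_isNoetherian_isArtinian] at *
  obtain ⟨_, _⟩ := hM
  obtain ⟨_, _⟩ := hP
  exact ⟨isNoetherian_of_range_eq_ker f g h.linearMap_ker_eq.symm,
    isArtinian_of_range_eq_ker f g h.linearMap_ker_eq.symm⟩

theorem ringKrullDim_quotient_span_pow {R : Type*} [CommRing R] (x : R) {n : ℕ} (hn : 0 < n) :
    ringKrullDim (R ⧸ Ideal.span {x ^ n}) = ringKrullDim (R ⧸ Ideal.span {x}) := by
  rw [ringKrullDim_quotient, ringKrullDim_quotient, PrimeSpectrum.zeroLocus_span,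
    PrimeSpectrum.zeroLocus_span, PrimeSpectrum.zeroLocus_singleton_pow x n hn]

/-- Let `(R, m, k)` be a Noetherian local ring (of any characteristic) and `x ∈ R` a
non-zero-divisor such that `m^s • H_m^i(R/xR) = 0` for some `s > 0` and some `i`.  Then
`m^{sℓ} • H_m^i(R/x^ℓ R) = 0` for every `ℓ > 0`.  In particular, if `R/xR` has FLC, then so
does `R/x^ℓ R` for every `ℓ > 0`. -/
theorem annihilator_of_local_cohomology_of_thickenings
    (R : Type) [CommRing R] [IsNoetherianRing R] [IsLocalRing R]
    (x : R) (hx : x ∈ nonZeroDivisors R) :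
    (∀ i : ℕ, ∀ s : ℕ, 0 < s →
      (∀ y ∈ maximalIdeal R ^ s,
        ∀ z : (localCohomology (maximalIdeal R) i).obj
          (ModuleCat.of R (R ⧸ Ideal.span {x})), y • z = 0) →
      ∀ ℓ : ℕ, 0 < ℓ → ∀ y ∈ maximalIdeal R ^ (s * ℓ),
        ∀ z : (localCohomology (maximalIdeal R) i).obj
          (ModuleCat.of R (R ⧸ Ideal.span {x ^ ℓ})), y • z = 0) ∧
    (HasFLCQuot R (Ideal.span {x}) →
      ∀ ℓ : ℕ, 0 < ℓ → HasFLCQuot R (Ideal.span {x ^ ℓ})) := by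
  refine ⟨fun i s _ h ℓ hℓ => ?_, fun h ℓ hℓ i hi => ?_⟩
  · induction ℓ, hℓ using Nat.le_induction with
    | base => rwa [Nat.succ_eq_add_one, zero_add, mul_one, pow_one]
    | succ ℓ _ ih =>
      obtain ⟨f, g, hfg⟩ := localCohomology_quotient_mul_exact (maximalIdeal R) i (x ^ ℓ) hx
      intro y hy
      rw [mul_add_one, pow_add] at hy
      rw [pow_succ]
      exact smul_eq_zero_of_exact hfg ih h hy
  · rw [ringKrullDim_quotient_span_pow x hℓ] at hi
    induction ℓ, hℓ using Nat.le_induction with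
    | base => rw [Nat.succ_eq_add_one, zero_add, pow_one]; exact h i hi
    | succ ℓ _ ih =>
      obtain ⟨f, g, hfg⟩ := localCohomology_quotient_mul_exact (maximalIdeal R) i (x ^ ℓ) hx
      rw [pow_succ]
      exact ih.of_exact hfg (h i hi)
end
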